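/- Let k be a field and n ≥ 2 a natural number. Let R = k[x_{ij} : 1 ≤ i ≤ n-1, 1 ≤ j ≤ n] be the polynomial ring over k in the n(n-1) entries of a generic (n-1) × n matrix X = (x_{ij}), and let I ⊆ R be the ideal generated by the determinants of the n maximal square submatrices of X (the (n-1) × (n-1) minors obtained by deleting one column). Then the Krull dimension of the quotient ring R/I is at most n(n-1) - 2. In particular, the determinantal variety of (n-1) × n matrices of non-maximal rank has codimension at least 2 in the affine space of all (n-1) × n matrices, so it is not a divisor. -/

import Mathlib

/-- In a unique factorization domain, a nonzero ideal whose elements have no common divisor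
other than units has codimension at least `2`. -/
lemma ringKrullDim_quotient_add_two_le {R : Type*} [CommRing R] [IsDomain R]
    [UniqueFactorizationMonoid R] {I : Ideal R} (hI : I ≠ ⊥)
    (hunit : ∀ d : R, (∀ x ∈ I, d ∣ x) → IsUnit d) :
    ringKrullDim (R ⧸ I) + 2 ≤ ringKrullDim R := by
  rcases subsingleton_or_nontrivial (R ⧸ I) with _ | _
  · simp [ringKrullDim_eq_bot_of_subsingleton]
  have : Nonempty (PrimeSpectrum.zeroLocus (R := R) I) := by
    rw [Set.nonempty_coe_sort, Set.nonempty_iff_ne_empty, ne_eq,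
      PrimeSpectrum.zeroLocus_empty_iff_eq_top]
    exact Ideal.Quotient.nontrivial_iff.mp ‹_›
  rw [ringKrullDim_quotient, Order.krullDim_eq_iSup_length, ringKrullDim,
    Order.krullDim_eq_iSup_length, ← WithBot.coe_ofNat, ← WithBot.coe_add,
    ENat.iSup_add, WithBot.coe_le_coe, iSup_le_iff]
  intro l
  have hIl : I ≤ l.head.1.asIdeal := l.head.2
  obtain ⟨p, hpl, hp⟩ := l.head.1.isPrime.exists_mem_prime_of_ne_bot
    fun h ↦ hI (le_bot_iff.mp (h ▸ hIl))
  let P : PrimeSpectrum R :=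
    ⟨Ideal.span {p}, (Ideal.span_singleton_prime hp.ne_zero).mpr hp⟩
  have hP : P < l.head.1 := by
    refine lt_of_le_of_ne ((Ideal.span_singleton_le_iff_mem _).mpr hpl) fun h ↦ ?_
    refine hp.not_isUnit (hunit p fun x hx ↦ Ideal.mem_span_singleton.mp ?_)
    exact (congrArg PrimeSpectrum.asIdeal h).ge (hIl hx)
  have hbot : ⊥ < P := by
    refine bot_lt_iff_ne_bot.mpr fun h ↦ hp.ne_zero ?_
    exact Ideal.span_singleton_eq_bot.mp (congrArg PrimeSpectrum.asIdeal h)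
  let l₁ := RelSeries.cons (l.map Subtype.val (Subtype.strictMono_coe _)) P hP
  let l₂ := l₁.cons ⊥ hbot
  have hlen : l₂.length = l.length + 2 :=
    (RelSeries.cons_length l₁ ⊥ hbot).trans (congrArg (· + 1) (RelSeries.cons_length _ P hP))
  refine le_trans ?_ (le_iSup _ l₂)
  rw [hlen, Nat.cast_add, Nat.cast_ofNat]

namespace MvPolynomial

lemma isUnit_of_dvd_of_forall_notMem_vars {σ k : Type*} [Field k] {d : MvPolynomial σ k}
    (hd : d ≠ 0) (h : ∀ s, ∃ f, f ≠ 0 ∧ d ∣ f ∧ s ∉ f.vars) : IsUnit d := by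
  classical
  have hvars : d.vars = ∅ := by
    refine Finset.eq_empty_of_forall_notMem fun s hs ↦ ?_
    obtain ⟨f, hf, ⟨e, rfl⟩, hsf⟩ := h s
    have he : e ≠ 0 := right_ne_zero_of_mul hf
    have hdeg := degreeOf_mul_eq (n := s) hd he
    rw [mem_vars_iff_degreeOf_ne_zero] at hs hsf
    omega
  rw [vars_eq_empty_iff_eq_C] at hvars
  rw [hvars] at hd ⊢
  exact (IsUnit.mk0 _ fun h0 ↦ hd (by rw [h0, C_0])).map C

end MvPolynomial

namespace Matrix

open MvPolynomial

variable {m n R : Type*} [Fintype m] [DecidableEq m] [CommRing R]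

lemma det_mvPolynomialX_submatrix (c : m → n) :
    ((mvPolynomialX m n R).submatrix id c).det =
      rename (Prod.map id c) (mvPolynomialX m m R).det := by
  rw [AlgHom.map_det]
  congr 1
  ext1 i j
  simp

lemma det_mvPolynomialX_submatrix_ne_zero [Nontrivial R] {c : m → n}
    (hc : Function.Injective c) : ((mvPolynomialX m n R).submatrix id c).det ≠ 0 := by
  rw [det_mvPolynomialX_submatrix, ne_eq,
    map_eq_zero_iff _ (rename_injective _ (Function.injective_id.prodMap hc))]
  exact det_mvPolynomialX_ne_zero m R

lemma notMem_vars_det_mvPolynomialX_submatrix {c : m → n} {i : m} {j : n}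
    (hj : j ∉ Set.range c) : (i, j) ∉ ((mvPolynomialX m n R).submatrix id c).det.vars := by
  intro h
  rw [det_mvPolynomialX_submatrix] at h
  obtain ⟨⟨_, l⟩, _, h⟩ := mem_vars_rename _ _ h
  exact hj ⟨l, congrArg Prod.snd h⟩

end Matrix

/-- The determinantal variety of `(n-1) × n` matrices of non-maximal rank has
codimension at least 2: if `I` is the ideal of the polynomial ring in the
entries of a generic `(n-1) × n` matrix generated by its `(n-1) × (n-1)` minors
(the determinants of the maximal square submatrices obtained by deleting one
column, i.e. by restricting along a strictly monotone map `Fin (n-1) → Fin n`),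
then the Krull dimension of the quotient is at most `n(n-1) - 2`. -/
theorem determinantal_ideal_krullDim_le
    (k : Type*) [Field k] (n : ℕ) (hn : 2 ≤ n)
    (X : Matrix (Fin (n - 1)) (Fin n) (MvPolynomial (Fin (n - 1) × Fin n) k))
    (hX : ∀ i j, X i j = MvPolynomial.X (i, j))
    (I : Ideal (MvPolynomial (Fin (n - 1) × Fin n) k))
    (hI : I = Ideal.span
      {d | ∃ c : Fin (n - 1) → Fin n, StrictMono c ∧
        d = Matrix.det (X.submatrix id c)}) :
    ringKrullDim (MvPolynomial (Fin (n - 1) × Fin n) k ⧸ I) ≤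
      (n * (n - 1) - 2 : ℕ) := by
  obtain ⟨m, rfl⟩ : ∃ m, n = m + 1 := ⟨n - 1, by omega⟩
  obtain rfl : X = Matrix.mvPolynomialX (Fin m) (Fin (m + 1)) k := by
    ext1 i j
    exact hX i j
  have hmem (j : Fin (m + 1)) :
      ((Matrix.mvPolynomialX (Fin m) (Fin (m + 1)) k).submatrix id j.succAbove).det ∈ I :=
    hI ▸ Ideal.subset_span ⟨j.succAbove, j.strictMono_succAbove, rfl⟩
  have hne (j : Fin (m + 1)) :
      ((Matrix.mvPolynomialX (Fin m) (Fin (m + 1)) k).submatrix id j.succAbove).det ≠ 0 :=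
    Matrix.det_mvPolynomialX_submatrix_ne_zero Fin.succAbove_right_injective
  have hunit (d : MvPolynomial (Fin m × Fin (m + 1)) k) (hd : ∀ x ∈ I, d ∣ x) : IsUnit d := by
    refine MvPolynomial.isUnit_of_dvd_of_forall_notMem_vars
      (ne_zero_of_dvd_ne_zero (hne 0) (hd _ (hmem 0))) fun ⟨i, j⟩ ↦
        ⟨_, hne j, hd _ (hmem j), Matrix.notMem_vars_det_mvPolynomialX_submatrix ?_⟩
    simp [Fin.range_succAbove]
  have hdim := ringKrullDim_quotient_add_two_le
    (Submodule.ne_bot_iff _ |>.mpr ⟨_, hmem 0, hne 0⟩) hunit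
  rw [MvPolynomial.ringKrullDim_of_isNoetherianRing, ringKrullDim_eq_zero_of_field, zero_add,
    Nat.card_prod, Nat.card_fin, Nat.card_fin] at hdim
  have hcard : m * (m + 1) = ((m + 1) * (m + 1 - 1) - 2) + 2 := by
    rw [Nat.add_sub_cancel, mul_comm m, Nat.sub_add_cancel]
    nlinarith
  rw [hcard, Nat.cast_add, Nat.cast_ofNat] at hdim
  exact ENat.WithBot.add_le_add_natCast_right_iff.mp hdim
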